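/- arXiv:1112.1896 — 9 statements merged into one kernel-verified Lean document; each statement's English description precedes it below -/
import Mathlib

section
/- The sequence (θ_n) for positive integers n is strictly increasing: θ_n < θ_{n+1} for every positive integer n. -/
open Real

noncomputable def ramanujanTheta (n : ℕ) : ℝ :=
  30 * (((Nat.factorial n : ℝ) / (Real.sqrt π * ((n : ℝ) / Real.exp 1) ^ n)) ^ 6
    - 8 * (n : ℝ) ^ 3 - 4 * (n : ℝ) ^ 2 - (n : ℝ))

open Filter Topology Finset in
/-- The Stirling lower bound with the first two terms of the asymptotic series. -/
theorem sqrt_pi_mul_exp_le_stirlingSeq {n : ℕ} (hn : n ≠ 0) :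
    √π * exp (1 / (12 * (n : ℝ)) - 1 / (360 * (n : ℝ) ^ 3)) ≤ Stirling.stirlingSeq n := by
  let g : ℝ → ℝ := fun x => 1 / (12 * x) - 1 / (360 * x ^ 3)
  let v : ℕ → ℝ := fun m => log (Stirling.stirlingSeq (m + 1)) - g ((m + 1 : ℕ) : ℝ)
  have hv : Antitone v := by
    refine antitone_nat_of_succ_le fun m => ?_
    have hs := (Stirling.log_stirlingSeq_sdiff_hasSum m).summable.sum_le_tsum (range 2)
      (fun k _ => by positivity)
    rw [(Stirling.log_stirlingSeq_sdiff_hasSum m).tsum_eq] at hs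
    have hg : g ((m + 1 : ℕ) : ℝ) - g ((m + 2 : ℕ) : ℝ) ≤
        ∑ k ∈ range 2, (1 : ℝ) / (2 * ↑(k + 1) + 1) *
          ((1 / (2 * ↑(m + 1) + 1)) ^ 2) ^ (k + 1) := by
      simp only [g, sum_range_succ, sum_range_zero]
      push_cast
      have hm : (0 : ℝ) ≤ m := m.cast_nonneg
      generalize (m : ℝ) = x at hm
      rw [← sub_nonneg]
      field_simp
      ring_nf
      positivity
    change log (Stirling.stirlingSeq (m + 2)) - g ((m + 2 : ℕ) : ℝ) ≤
      log (Stirling.stirlingSeq (m + 1)) - g ((m + 1 : ℕ) : ℝ)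
    linarith
  have hcast : Tendsto (fun m : ℕ => ((m + 1 : ℕ) : ℝ)) atTop atTop :=
    tendsto_natCast_atTop_atTop.comp (tendsto_add_atTop_nat 1)
  have hg : Tendsto g atTop (𝓝 0) := by
    have h1 : Tendsto (fun x : ℝ => 1 / (12 * x)) atTop (𝓝 0) :=
      tendsto_const_nhds.div_atTop (tendsto_id.const_mul_atTop (by norm_num))
    have h3 : Tendsto (fun x : ℝ => 1 / (360 * x ^ 3)) atTop (𝓝 0) :=
      tendsto_const_nhds.div_atTop
        ((tendsto_pow_atTop (by norm_num)).const_mul_atTop (by norm_num))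
    simpa only [sub_zero] using h1.sub h3
  have hlim : Tendsto v atTop (𝓝 (log √π)) := by
    have h := ((continuousAt_log (by positivity : √π ≠ 0)).tendsto.comp
      (Stirling.tendsto_stirlingSeq_sqrt_pi.comp (tendsto_add_atTop_nat 1))).sub (hg.comp hcast)
    rw [sub_zero] at h
    exact h
  obtain ⟨m, rfl⟩ := Nat.exists_eq_succ_of_ne_zero hn
  have h := hv.le_of_tendsto hlim m
  rw [← log_le_log_iff (by positivity) (Stirling.stirlingSeq'_pos m),
    log_mul (by positivity) (exp_ne_zero _), log_exp]
  simp only [v, g] at h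
  simp only [Nat.succ_eq_add_one]
  linarith

open Finset in
theorem log_one_add_inv_le {x : ℝ} (hx : 0 < x) :
    log (1 + x⁻¹) ≤ 2 / (2 * x + 1) + 2 / (3 * (2 * x + 1) ^ 3)
      + 1 / (10 * x * (x + 1) * (2 * x + 1) ^ 3) := by
  have hsum := hasSum_log_one_add_inv hx
  have htail := (hasSum_nat_add_iff' 2).mpr hsum
  have hr : (1 / (2 * x + 1)) ^ 2 < 1 := by
    rw [div_pow, one_pow, div_lt_one (by positivity)]
    nlinarith
  have hgeo := (hasSum_geometric_of_lt_one (by positivity) hr).mul_left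
    (2 / 5 * (1 / (2 * x + 1)) ^ 5)
  have hle := hasSum_le (fun k => ?_) htail hgeo
  · have hval : 2 / 5 * (1 / (2 * x + 1)) ^ 5 * (1 - (1 / (2 * x + 1)) ^ 2)⁻¹ =
        1 / (10 * x * (x + 1) * (2 * x + 1) ^ 3) := by
      have h1 : 1 - (1 / (2 * x + 1)) ^ 2 = 4 * x * (x + 1) / (2 * x + 1) ^ 2 := by
        field_simp
        ring
      rw [h1]
      field_simp
      ring
    have h2 : ∑ i ∈ range 2, 2 * (1 / (2 * (i : ℝ) + 1)) * (1 / (2 * x + 1)) ^ (2 * i + 1) =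
        2 / (2 * x + 1) + 2 / (3 * (2 * x + 1) ^ 3) := by
      simp only [sum_range_succ, sum_range_zero]
      push_cast
      field_simp
      ring
    rw [hval, h2] at hle
    linarith
  · have hk : 1 / (2 * ((k + 2 : ℕ) : ℝ) + 1) ≤ 1 / 5 := by
      apply one_div_le_one_div_of_le (by norm_num)
      push_cast
      linarith [k.cast_nonneg (α := ℝ)]
    calc 2 * (1 / (2 * ((k + 2 : ℕ) : ℝ) + 1)) * (1 / (2 * x + 1)) ^ (2 * (k + 2) + 1)
        ≤ 2 * (1 / 5) * (1 / (2 * x + 1)) ^ (2 * (k + 2) + 1) := by gcongr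
      _ = 2 / 5 * (1 / (2 * x + 1)) ^ 5 * ((1 / (2 * x + 1)) ^ 2) ^ k := by ring

/-- The sixth power of `n! / (√π (n / e) ^ n)`. -/
noncomputable def stirlingSixth (n : ℕ) : ℝ :=
  ((Nat.factorial n : ℝ) / (√π * ((n : ℝ) / exp 1) ^ n)) ^ 6

theorem stirlingSixth_eq_stirlingSeq {n : ℕ} (hn : 0 < n) :
    stirlingSixth n = (Stirling.stirlingSeq n / √π) ^ 6 * (8 * (n : ℝ) ^ 3) := by
  have h : √(2 * (n : ℝ)) ^ 6 = 8 * (n : ℝ) ^ 3 := by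
    calc √(2 * (n : ℝ)) ^ 6 = (√(2 * (n : ℝ)) ^ 2) ^ 3 := by ring
      _ = 8 * (n : ℝ) ^ 3 := by rw [sq_sqrt (by positivity)]; ring
  rw [← h, ← mul_pow, stirlingSixth, Stirling.stirlingSeq]
  congr 1
  field_simp

theorem stirlingSixth_succ {n : ℕ} (hn : 0 < n) :
    stirlingSixth (n + 1) =
      stirlingSixth n * exp (6 * (1 - n * log (1 + (n : ℝ)⁻¹))) := by
  have hn' : (0 : ℝ) < n := Nat.cast_pos.mpr hn
  have h : exp (n * log (1 + (n : ℝ)⁻¹)) = ((n + 1 : ℝ) / n) ^ n := by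
    rw [exp_nat_mul, exp_log (by positivity)]
    congr 1
    field_simp
  rw [show 6 * (1 - n * log (1 + (n : ℝ)⁻¹)) = ((6 : ℕ) : ℝ) * (1 - n * log (1 + (n : ℝ)⁻¹)) by
    norm_num, exp_nat_mul, exp_sub, h, stirlingSixth, stirlingSixth, ← mul_pow,
    Nat.factorial_succ]
  congr 1
  push_cast
  simp only [div_pow, pow_succ]
  field_simp

open Finset in
theorem lt_stirlingSixth {n : ℕ} (hn : 7 ≤ n) :
    8 * (n : ℝ) ^ 3 + 4 * (n : ℝ) ^ 2 + n + 1 / 30 - 1 / (20 * n) < stirlingSixth n := by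
  have hn' : (7 : ℝ) ≤ n := by exact_mod_cast hn
  have h0 : (0 : ℝ) < n := by linarith
  have hb : exp (1 / (2 * (n : ℝ)) - 1 / (60 * (n : ℝ) ^ 3)) ≤
      (Stirling.stirlingSeq n / √π) ^ 6 := by
    have h := sqrt_pi_mul_exp_le_stirlingSeq (n := n) (by omega)
    have h' : exp (1 / (12 * (n : ℝ)) - 1 / (360 * (n : ℝ) ^ 3)) ≤ Stirling.stirlingSeq n / √π := by
      rw [le_div_iff₀ (by positivity)]
      linarith
    calc exp (1 / (2 * (n : ℝ)) - 1 / (60 * (n : ℝ) ^ 3))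
        = exp (1 / (12 * (n : ℝ)) - 1 / (360 * (n : ℝ) ^ 3)) ^ 6 := by
          rw [← exp_nat_mul]
          congr 1
          push_cast
          field_simp
          ring
      _ ≤ _ := by gcongr
  have hz : 0 ≤ 1 / (2 * (n : ℝ)) - 1 / (60 * (n : ℝ) ^ 3) := by
    rw [sub_nonneg]
    apply one_div_le_one_div_of_le (by positivity)
    nlinarith [pow_pos h0 2]
  have ht := (sum_le_exp_of_nonneg hz 5).trans hb
  rw [stirlingSixth_eq_stirlingSeq (by omega)]
  refine lt_of_lt_of_le ?_ (mul_le_mul_of_nonneg_right ht (by positivity))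
  obtain ⟨x, hx, hxn⟩ : ∃ x : ℝ, 0 ≤ x ∧ (n : ℝ) = x + 7 := ⟨n - 7, by linarith, by ring⟩
  rw [hxn]
  simp only [sum_range_succ, sum_range_zero, Nat.factorial]
  push_cast
  rw [← sub_pos]
  field_simp
  ring_nf
  positivity

theorem truncated_expansion_pos {x : ℝ} (hx : 1 ≤ x) :
    0 < 8 * x ^ 3 + 4 * x ^ 2 + x + 1 / 30 - 1 / (20 * x) := by
  have : 1 / (20 * x) ≤ 1 := by
    rw [div_le_one (by positivity)]
    linarith
  have : 0 ≤ 8 * x ^ 3 + 4 * x ^ 2 := by positivity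
  linarith

open Finset in
theorem lt_mul_exp_sub_one {n : ℕ} (hn : 7 ≤ n) :
    24 * (n : ℝ) ^ 2 + 32 * n + 13 <
      (8 * (n : ℝ) ^ 3 + 4 * (n : ℝ) ^ 2 + n + 1 / 30 - 1 / (20 * n)) *
        (exp (6 * (1 - n * log (1 + (n : ℝ)⁻¹))) - 1) := by
  have hn' : (7 : ℝ) ≤ n := by exact_mod_cast hn
  obtain ⟨x, hx, hxn⟩ : ∃ x : ℝ, 0 ≤ x ∧ (n : ℝ) = x + 7 := ⟨n - 7, by linarith, by ring⟩
  rw [hxn]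
  have hlog := log_one_add_inv_le (x := x + 7) (by linarith)
  have hW : 6 * (30 * (2 * (x + 7) + 1) ^ 2 * (x + 8) - 20 * (x + 7) * (x + 8) - 3) /
      (30 * (2 * (x + 7) + 1) ^ 3 * (x + 8)) ≤ 6 * (1 - (x + 7) * log (1 + (x + 7)⁻¹)) := by
    have := mul_le_mul_of_nonneg_left hlog (by linarith : 0 ≤ x + 7)
    refine le_trans (le_of_eq ?_) (mul_le_mul_of_nonneg_left (sub_le_sub_left this 1)
      (by norm_num : (0 : ℝ) ≤ 6))
    rw [show x + 7 + 1 = x + 8 by ring]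
    field_simp
    ring
  have hW0 : 0 ≤ 6 * (30 * (2 * (x + 7) + 1) ^ 2 * (x + 8) - 20 * (x + 7) * (x + 8) - 3) /
      (30 * (2 * (x + 7) + 1) ^ 3 * (x + 8)) := by
    ring_nf
    positivity
  have he := (sum_le_exp_of_nonneg hW0 9).trans (exp_le_exp.mpr hW)
  have hG := (truncated_expansion_pos (x := x + 7) (by linarith)).le
  refine lt_of_lt_of_le ?_ (mul_le_mul_of_nonneg_left (sub_le_sub_right he 1) hG)
  simp only [sum_range_succ, sum_range_zero, Nat.factorial]
  push_cast
  rw [← sub_pos]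
  field_simp
  ring_nf
  positivity

theorem stirlingSixth_eq (m : ℕ) : stirlingSixth m =
    (m.factorial : ℝ) ^ 6 * exp 1 ^ (6 * m) / (π ^ 3 * (m : ℝ) ^ (6 * m)) := by
  have hs : √π ^ 6 = π ^ 3 := by
    calc √π ^ 6 = (√π ^ 2) ^ 3 := by ring
      _ = π ^ 3 := by rw [sq_sqrt pi_pos.le]
  rw [stirlingSixth, div_pow, mul_pow, hs, div_pow, div_pow, ← pow_mul, ← pow_mul,
    mul_comm m 6]
  field_simp

theorem lt_exp_one_pow_mul_div_pi_pow {A B C : ℝ} (k : ℕ) (hA : 0 ≤ A) (hC : 0 ≤ C)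
    (hB : 0 ≤ A * 2.7182818283 ^ 6 - B)
    (h : C * 3.14159265358979323847 ^ 3 <
      2.7182818283 ^ (6 * k) * (A * 2.7182818283 ^ 6 - B)) :
    C < exp 1 ^ (6 * k) * (A * exp 1 ^ 6 - B) / π ^ 3 := by
  have he := exp_one_gt_d9
  have hp := pi_lt_d20
  rw [lt_div_iff₀ (by positivity)]
  calc C * π ^ 3 ≤ C * 3.14159265358979323847 ^ 3 := by gcongr
    _ < _ := h
    _ ≤ exp 1 ^ (6 * k) * (A * exp 1 ^ 6 - B) := by gcongr

theorem ramanujanTheta_strictMono (n : ℕ) (hn : 0 < n) :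
    ramanujanTheta n < ramanujanTheta (n + 1) := by
  suffices h : 24 * (n : ℝ) ^ 2 + 32 * n + 13 < stirlingSixth (n + 1) - stirlingSixth n by
    have h1 : ∀ m : ℕ, ramanujanTheta m =
      30 * (stirlingSixth m - 8 * (m : ℝ) ^ 3 - 4 * (m : ℝ) ^ 2 - m) := fun _ => rfl
    rw [h1, h1]
    push_cast
    nlinarith
  rcases le_or_gt 7 n with h7 | h7
  · have hq := lt_mul_exp_sub_one h7
    have hF := lt_stirlingSixth h7
    have hn' : (7 : ℝ) ≤ n := by exact_mod_cast h7
    have hG := truncated_expansion_pos (x := n) (by linarith)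
    have hq0 := (pos_iff_pos_of_mul_pos (hq.trans' (by positivity))).mp hG
    rw [stirlingSixth_succ hn]
    linarith [mul_le_mul_of_nonneg_right hF.le hq0.le]
  · have hdiff : stirlingSixth (n + 1) - stirlingSixth n = exp 1 ^ (6 * n) *
        ((((n + 1).factorial : ℝ) ^ 6 / ((n + 1 : ℕ) : ℝ) ^ (6 * (n + 1))) * exp 1 ^ 6 -
          ((n.factorial : ℝ) ^ 6 / (n : ℝ) ^ (6 * n))) / π ^ 3 := by
      rw [stirlingSixth_eq, stirlingSixth_eq, mul_add, pow_add (exp 1)]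
      field_simp
      ring
    rw [hdiff]
    refine lt_exp_one_pow_mul_div_pi_pow n (by positivity) (by positivity) ?_ ?_ <;>
      interval_cases n <;> norm_num [Nat.factorial]
end

section
/- For every positive integer n, ln(a_n / a_{n+1}) > (1/12)·(1/n - 1/(n+1)) - (1/360)·(1/n³ - 1/(n+1)³). -/
noncomputable def ramanujanA (n : ℕ) : ℝ :=
  (Nat.factorial n : ℝ) / (Real.sqrt n * ((n : ℝ) / Real.exp 1) ^ n)

theorem log_ramanujanA {n : ℕ} (hn : 0 < n) :
    Real.log (ramanujanA n) =
      Real.log (Nat.factorial n) - (Real.log n / 2 + n * (Real.log n - 1)) := by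
  have h : (0 : ℝ) < n := by exact_mod_cast hn
  have hf : (Nat.factorial n : ℝ) ≠ 0 := by positivity
  rw [ramanujanA, Real.log_div hf (by positivity), Real.log_mul (by positivity) (by positivity),
    Real.log_sqrt h.le, Real.log_pow, Real.log_div h.ne' (by positivity), Real.log_exp]

theorem ramanujanA_pos {n : ℕ} (hn : 0 < n) : 0 < ramanujanA n := by
  unfold ramanujanA
  positivity

theorem log_ramanujanA_div_succ {n : ℕ} (hn : 0 < n) :
    Real.log (ramanujanA n / ramanujanA (n + 1)) =
      ((n : ℝ) + 1 / 2) * Real.log (1 + (n : ℝ)⁻¹) - 1 := by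
  have h : (0 : ℝ) < n := by exact_mod_cast hn
  have hs : 1 + (n : ℝ)⁻¹ = ((n : ℝ) + 1) / n := by field_simp
  rw [Real.log_div (ramanujanA_pos hn).ne' (ramanujanA_pos n.succ_pos).ne',
    log_ramanujanA hn, log_ramanujanA n.succ_pos, hs, Real.log_div (by positivity) h.ne',
    Nat.factorial_succ]
  push_cast
  rw [Real.log_mul (by positivity) (by positivity)]
  ring

theorem le_log_one_add_inv {a : ℝ} (ha : 0 < a) :
    2 * (1 / (2 * a + 1)) + 2 / 3 * (1 / (2 * a + 1)) ^ 3 + 2 / 5 * (1 / (2 * a + 1)) ^ 5 ≤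
      Real.log (1 + a⁻¹) := by
  have h := sum_le_hasSum (Finset.range 3) (fun k _ => by positivity)
    (Real.hasSum_log_one_add_inv ha)
  norm_num [Finset.sum_range_succ] at h ⊢
  linarith

theorem stirling_correction_lt {a : ℝ} (ha : 0 < a) :
    (1 / 12) * (1 / a - 1 / (a + 1)) - (1 / 360) * (1 / a ^ 3 - 1 / (a + 1) ^ 3) <
      (a + 1 / 2) * (2 * (1 / (2 * a + 1)) + 2 / 3 * (1 / (2 * a + 1)) ^ 3 +
        2 / 5 * (1 / (2 * a + 1)) ^ 5) - 1 := by
  rw [← sub_pos]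
  have key : (a + 1 / 2) * (2 * (1 / (2 * a + 1)) + 2 / 3 * (1 / (2 * a + 1)) ^ 3 +
        2 / 5 * (1 / (2 * a + 1)) ^ 5) - 1 -
      ((1 / 12) * (1 / a - 1 / (a + 1)) - (1 / 360) * (1 / a ^ 3 - 1 / (a + 1) ^ 3)) =
      (5 * (2 * a + 1) ^ 4 + 12 * (2 * a + 1) ^ 2 - 9) /
        (2880 * (2 * a + 1) ^ 4 * a ^ 3 * (a + 1) ^ 3) := by
    field_simp
    ring
  rw [key]
  have hnum : 5 * (2 * a + 1) ^ 4 + 12 * (2 * a + 1) ^ 2 - 9 =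
      80 * a ^ 4 + 160 * a ^ 3 + 168 * a ^ 2 + 88 * a + 8 := by ring
  rw [hnum]
  positivity

theorem log_ratio_lower_bound (n : ℕ) (hn : 0 < n) :
    Real.log (ramanujanA n / ramanujanA (n + 1)) >
      (1 / 12) * (1 / (n : ℝ) - 1 / ((n : ℝ) + 1))
        - (1 / 360) * (1 / (n : ℝ) ^ 3 - 1 / ((n : ℝ) + 1) ^ 3) := by
  have h : (0 : ℝ) < n := by exact_mod_cast hn
  rw [log_ramanujanA_div_succ hn, gt_iff_lt]
  refine (stirling_correction_lt h).trans_le ?_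
  gcongr
  exact le_log_one_add_inv h
end

section
/- For every positive integer n, a_n ≥ √(2π) · exp(1/(12n) - 1/(360n³)). -/
open Real

/-- Lower bound for the decrement of `log (stirlingSeq n)` by the decrement of
`1 / (12 n) - 1 / (360 n ^ 3)`. -/
theorem log_stirlingSeq_sub_log_succ_ge (m : ℕ) :
    (1 / (12 * ((m : ℝ) + 1)) - 1 / (360 * ((m : ℝ) + 1) ^ 3)) -
      (1 / (12 * ((m : ℝ) + 2)) - 1 / (360 * ((m : ℝ) + 2) ^ 3)) ≤
    Real.log (Stirling.stirlingSeq (m + 1)) - Real.log (Stirling.stirlingSeq (m + 2)) := by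
  have hsum := Stirling.log_stirlingSeq_sdiff_hasSum m
  have hpartial := sum_le_hasSum (Finset.range 2) (fun i _ => by positivity) hsum
  refine le_trans ?_ hpartial
  simp only [Finset.sum_range_succ, Finset.sum_range_zero]
  push_cast
  have hm : (0 : ℝ) ≤ m := m.cast_nonneg
  rw [← sub_nonneg]
  field_simp
  ring_nf
  positivity

/-- The logarithm of `stirlingSeq`, corrected by two terms of its asymptotic expansion,
is antitone. -/
theorem antitone_log_stirlingSeq_succ_sub :
    Antitone fun m : ℕ => Real.log (Stirling.stirlingSeq (m + 1)) -
      (1 / (12 * ((m : ℝ) + 1)) - 1 / (360 * ((m : ℝ) + 1) ^ 3)) := by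
  refine antitone_nat_of_succ_le fun m => ?_
  have h := log_stirlingSeq_sub_log_succ_ge m
  push_cast
  rw [show (m : ℝ) + 1 + 1 = m + 2 by ring]
  linarith

theorem tendsto_log_stirlingSeq_succ_sub :
    Filter.Tendsto (fun m : ℕ => Real.log (Stirling.stirlingSeq (m + 1)) -
      (1 / (12 * ((m : ℝ) + 1)) - 1 / (360 * ((m : ℝ) + 1) ^ 3)))
      Filter.atTop (nhds (Real.log √π)) := by
  have hlog : Filter.Tendsto (fun m : ℕ => Real.log (Stirling.stirlingSeq (m + 1)))
      Filter.atTop (nhds (Real.log √π)) :=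
    ((Filter.tendsto_add_atTop_iff_nat 1).2 Stirling.tendsto_stirlingSeq_sqrt_pi).log
      (by positivity)
  have hinv : Filter.Tendsto (fun m : ℕ => 1 / ((m : ℝ) + 1)) Filter.atTop (nhds 0) :=
    tendsto_one_div_add_atTop_nhds_zero_nat
  have h := hlog.sub ((hinv.const_mul (1 / 12)).sub ((hinv.pow 3).const_mul (1 / 360)))
  convert h using 1
  · funext m
    field_simp
  · norm_num

theorem ramanujanA_eq_sqrt_two_mul_stirlingSeq (n : ℕ) :
    ramanujanA n = √2 * Stirling.stirlingSeq n := by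
  rw [ramanujanA, Stirling.stirlingSeq, Real.sqrt_mul (by norm_num), mul_assoc, ← mul_div_assoc,
    mul_div_mul_left _ _ (by positivity)]

theorem ramanujanA_ge (n : ℕ) (hn : 0 < n) :
    ramanujanA n ≥ Real.sqrt (2 * π) *
      Real.exp (1 / (12 * (n : ℝ)) - 1 / (360 * (n : ℝ) ^ 3)) := by
  obtain ⟨m, rfl⟩ := Nat.exists_eq_succ_of_ne_zero hn.ne'
  have h := antitone_log_stirlingSeq_succ_sub.le_of_tendsto tendsto_log_stirlingSeq_succ_sub m
  have hexp := Real.exp_le_exp.2 (le_sub_iff_add_le.1 h)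
  rw [Real.exp_add, Real.exp_log (by positivity), Real.exp_log (Stirling.stirlingSeq'_pos m)]
    at hexp
  rw [ramanujanA_eq_sqrt_two_mul_stirlingSeq, Real.sqrt_mul (by norm_num), mul_assoc, ge_iff_le,
    Nat.succ_eq_add_one]
  push_cast
  gcongr
end

section
/- For every positive integer n, (n! / (√π · (n/e)^n))^6 - 8n³ - 4n² - n ≥ (1 - 3/(2n)) / 30. -/
open Real

open Filter Topology Stirling in
/-- If `F (m + 1) - F (m + 2)` is bounded by the first two terms of the series for
`log (stirlingSeq (m + 1)) - log (stirlingSeq (m + 2))` and `F` vanishes at infinity, then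
`log √π + F n` is a lower bound for `log (stirlingSeq n)`. -/
lemma log_sqrt_pi_add_le_log_stirlingSeq {F : ℕ → ℝ} (hF : Tendsto F atTop (𝓝 0))
    (hstep : ∀ m : ℕ, F (m + 1) - F (m + 2) ≤
      (1 / (2 * ((m : ℝ) + 1) + 1)) ^ 2 / 3 + (1 / (2 * ((m : ℝ) + 1) + 1)) ^ 4 / 5) (m : ℕ) :
    log √π + F (m + 1) ≤ log (stirlingSeq (m + 1)) := by
  have hanti : Antitone fun k : ℕ => log (stirlingSeq (k + 1)) - F (k + 1) := by
    refine antitone_nat_of_succ_le fun k => ?_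
    have hsum := sum_le_hasSum (Finset.range 2) (fun i _ => by positivity)
      (log_stirlingSeq_sdiff_hasSum k)
    simp only [Finset.sum_range_succ, Finset.sum_range_zero] at hsum
    push_cast at hsum
    have := hstep k
    have hk : k + 1 + 1 = k + 2 := rfl
    rw [hk]
    ring_nf at hsum this ⊢
    linarith
  have hlim : Tendsto (fun k : ℕ => log (stirlingSeq (k + 1)) - F (k + 1)) atTop
      (𝓝 (log √π - 0)) :=
    ((tendsto_stirlingSeq_sqrt_pi.log (by positivity)).sub hF).comp (tendsto_add_atTop_nat 1)
  have := hanti.le_of_tendsto hlim m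
  simp only [sub_zero] at this
  linarith

/-- `60 n` times the polynomial `8 n³ + 4 n² + n + (1 - 3 / (2 n)) / 30`. -/
def ramanujanQuartic (x : ℝ) : ℝ := 480 * x ^ 4 + 240 * x ^ 3 + 60 * x ^ 2 + 2 * x - 3

lemma ramanujanQuartic_pos {x : ℝ} (hx : 1 ≤ x) : 0 < ramanujanQuartic x := by
  have : 1 ≤ x ^ 2 := one_le_pow₀ hx
  unfold ramanujanQuartic
  nlinarith [pow_pos (zero_lt_one.trans_le hx) 3, pow_pos (zero_lt_one.trans_le hx) 4]

/-- `t ^ 4 * ramanujanQuartic x` in terms of `t = 1 / (2 x + 1)`. -/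
def ramanujanLower (t : ℝ) : ℝ := 30 - 90 * t + 105 * t ^ 2 - 59 * t ^ 3 + 11 * t ^ 4

/-- `t ^ 4 * ramanujanQuartic (x + 1)` in terms of `t = 1 / (2 x + 1)`. -/
def ramanujanUpper (t : ℝ) : ℝ := 30 + 150 * t + 285 * t ^ 2 + 241 * t ^ 3 + 73 * t ^ 4

lemma ramanujanLower_pos {t : ℝ} (h0 : 0 ≤ t) (h1 : t ≤ 1 / 3) : 0 < ramanujanLower t := by
  have h2 : 0 ≤ t ^ 2 * (1 / 3 - t) := mul_nonneg (by positivity) (by linarith)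
  unfold ramanujanLower
  nlinarith [sq_nonneg (t - 1 / 3), pow_nonneg h0 4]

lemma ramanujanUpper_pos {t : ℝ} (h0 : 0 ≤ t) : 0 < ramanujanUpper t := by
  unfold ramanujanUpper
  positivity

lemma hasDerivAt_ramanujanLower (t : ℝ) :
    HasDerivAt ramanujanLower (-90 + 210 * t - 177 * t ^ 2 + 44 * t ^ 3) t := by
  unfold ramanujanLower
  have h := (((((hasDerivAt_id' t).const_mul 90).const_sub 30).add
    (((hasDerivAt_id' t).pow 2).const_mul 105)).sub
    (((hasDerivAt_id' t).pow 3).const_mul 59)).add (((hasDerivAt_id' t).pow 4).const_mul 11)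
  refine h.congr_deriv ?_
  norm_num
  ring

lemma hasDerivAt_ramanujanUpper (t : ℝ) :
    HasDerivAt ramanujanUpper (150 + 570 * t + 723 * t ^ 2 + 292 * t ^ 3) t := by
  unfold ramanujanUpper
  have h := (((((hasDerivAt_id' t).const_mul 150).const_add 30).add
    (((hasDerivAt_id' t).pow 2).const_mul 285)).add
    (((hasDerivAt_id' t).pow 3).const_mul 241)).add (((hasDerivAt_id' t).pow 4).const_mul 73)
  refine h.congr_deriv ?_
  norm_num
  ring

lemma four_log_add_log_ramanujanLower_le {t : ℝ} (h0 : 0 ≤ t) (h1 : t ≤ 1 / 3) :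
    4 * log (1 + t) - 4 * log (1 - t) + log (ramanujanLower t) - log (ramanujanUpper t) ≤
      2 * t ^ 2 + 6 / 5 * t ^ 4 := by
  let G : ℝ → ℝ := fun s => 2 * s ^ 2 + 6 / 5 * s ^ 4 - 4 * log (1 + s) + 4 * log (1 - s)
    - log (ramanujanLower s) + log (ramanujanUpper s)
  have hderiv : ∀ s ∈ Set.Icc (0 : ℝ) (1 / 3), HasDerivAt G
      (s ^ 4 * (300 + 600 * s + 5022 * s ^ 2 + 676 * s ^ 3 + 18078 * s ^ 4 - 43336 / 5 * s ^ 5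
        - 92304 / 5 * s ^ 6 + 85268 / 5 * s ^ 7 + 39744 / 5 * s ^ 8 - 19272 / 5 * s ^ 9)
        / ((1 + s) * (1 - s) * ramanujanLower s * ramanujanUpper s)) s := by
    rintro s ⟨hs0, hs1⟩
    have hp : 1 + s ≠ 0 := by linarith
    have hm : 1 - s ≠ 0 := by linarith
    have hL := (ramanujanLower_pos hs0 hs1).ne'
    have hU := (ramanujanUpper_pos hs0).ne'
    have h := ((((((hasDerivAt_id' s).pow 2).const_mul 2).add
      (((hasDerivAt_id' s).pow 4).const_mul (6 / 5))).sub
      ((((hasDerivAt_id' s).const_add 1).log hp).const_mul 4)).add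
      ((((hasDerivAt_id' s).const_sub 1).log hm).const_mul 4)).sub
      ((hasDerivAt_ramanujanLower s).log hL) |>.add ((hasDerivAt_ramanujanUpper s).log hU)
    refine h.congr_deriv ?_
    norm_num
    field_simp
    unfold ramanujanLower ramanujanUpper
    ring
  have hmono : MonotoneOn G (Set.Icc 0 (1 / 3)) := by
    refine monotoneOn_of_deriv_nonneg (convex_Icc _ _)
      (fun s hs => (hderiv s hs).continuousAt.continuousWithinAt)
      (fun s hs => (hderiv s (interior_subset hs)).differentiableAt.differentiableWithinAt)
      fun s hs => ?_
    have hs' := interior_subset hs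
    rw [(hderiv s hs').deriv]
    obtain ⟨hs0, hs1⟩ := hs'
    have hL := ramanujanLower_pos hs0 hs1
    have hU := ramanujanUpper_pos hs0
    have hm : 0 < 1 - s := by linarith
    have h5 : 0 ≤ s ^ 4 * (1 / 3 - s) := mul_nonneg (by positivity) (by linarith)
    have h6 : 0 ≤ s ^ 5 * (1 / 3 - s) := mul_nonneg (by positivity) (by linarith)
    have h9 : 0 ≤ s ^ 8 * (1 / 3 - s) := mul_nonneg (by positivity) (by linarith)
    have h4 : 0 ≤ s ^ 4 := by positivity
    have h7 : 0 ≤ s ^ 7 := by positivity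
    have h8 : 0 ≤ s ^ 8 := by positivity
    have h2 : 0 ≤ s ^ 2 := by positivity
    have h3 : 0 ≤ s ^ 3 := by positivity
    refine div_nonneg (mul_nonneg h4 ?_) (by positivity)
    linarith
  have h := hmono (Set.left_mem_Icc.2 (by norm_num)) (Set.mem_Icc.2 ⟨h0, h1⟩) h0
  simp only [G, ramanujanLower, ramanujanUpper] at h
  norm_num at h
  simp only [ramanujanLower, ramanujanUpper]
  linarith

lemma log_ramanujanQuartic_sub_le {x : ℝ} (hx : 1 ≤ x) :
    (log (ramanujanQuartic x) - 4 * log x) -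
        (log (ramanujanQuartic (x + 1)) - 4 * log (x + 1)) ≤
      2 * (1 / (2 * x + 1)) ^ 2 + 6 / 5 * (1 / (2 * x + 1)) ^ 4 := by
  have hx0 : 0 < x := by linarith
  set t : ℝ := 1 / (2 * x + 1) with ht
  have ht0 : 0 < t := by positivity
  have ht1 : t ≤ 1 / 3 := one_div_le_one_div_of_le (by norm_num) (by linarith)
  have key := four_log_add_log_ramanujanLower_le ht0.le ht1
  have hp : 1 + t = 2 * t * (x + 1) := by rw [ht]; field
  have hm : 1 - t = 2 * t * x := by rw [ht]; field
  have hL : ramanujanLower t = t ^ 4 * ramanujanQuartic x := by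
    rw [ht, ramanujanLower, ramanujanQuartic]; field
  have hU : ramanujanUpper t = t ^ 4 * ramanujanQuartic (x + 1) := by
    rw [ht, ramanujanUpper, ramanujanQuartic]; field
  have h2t : 2 * t ≠ 0 := by positivity
  have ht4 : t ^ 4 ≠ 0 := by positivity
  rw [hp, hm, hL, hU, log_mul h2t (by positivity), log_mul h2t hx0.ne',
    log_mul ht4 (ramanujanQuartic_pos hx).ne',
    log_mul ht4 (ramanujanQuartic_pos (by linarith)).ne'] at key
  linarith

open Filter Topology in
lemma tendsto_log_ramanujanQuartic :
    Tendsto (fun n : ℕ => (log (ramanujanQuartic n) - 4 * log n - log 480) / 6) atTop (𝓝 0) := by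
  have hinv := tendsto_inv_atTop_nhds_zero_nat (𝕜 := ℝ)
  have hlim : Tendsto (fun n : ℕ => (480 : ℝ) + 240 * (n : ℝ)⁻¹ + 60 * (n : ℝ)⁻¹ ^ 2
      + 2 * (n : ℝ)⁻¹ ^ 3 - 3 * (n : ℝ)⁻¹ ^ 4) atTop (𝓝 480) := by
    have h := ((((hinv.const_mul 240).const_add 480).add ((hinv.pow 2).const_mul 60)).add
      ((hinv.pow 3).const_mul 2)).sub ((hinv.pow 4).const_mul 3)
    norm_num at h
    simpa using h
  have h := ((hlim.log (by norm_num)).sub_const (log 480)).div_const 6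
  rw [sub_self, zero_div] at h
  refine h.congr' ?_
  filter_upwards [eventually_ge_atTop 1] with n hn
  have hn1 : (1 : ℝ) ≤ n := by exact_mod_cast hn
  have hn0 : (n : ℝ) ≠ 0 := by positivity
  have hlog : log (ramanujanQuartic n) - 4 * log n = log (ramanujanQuartic n / (n : ℝ) ^ 4) := by
    rw [log_div (ramanujanQuartic_pos hn1).ne' (by positivity), log_pow]
    norm_num
  rw [hlog, ramanujanQuartic]
  congr 3
  field

lemma ramanujanQuartic_div_le_stirlingSeq_pow {n : ℕ} (hn : 0 < n) :
    √π ^ 6 * (ramanujanQuartic n / (480 * (n : ℝ) ^ 4)) ≤ Stirling.stirlingSeq n ^ 6 := by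
  obtain ⟨m, rfl⟩ := Nat.exists_eq_add_of_le' hn
  have h := log_sqrt_pi_add_le_log_stirlingSeq tendsto_log_ramanujanQuartic (fun k => by
    have := log_ramanujanQuartic_sub_le (x := (k : ℝ) + 1) (by linarith [k.cast_nonneg (α := ℝ)])
    push_cast
    rw [show (k : ℝ) + 2 = k + 1 + 1 by ring]
    linarith) m
  have hm : (1 : ℝ) ≤ (m + 1 : ℕ) := by exact_mod_cast Nat.le_add_left 1 m
  have hq := ramanujanQuartic_pos hm
  have hA := Stirling.stirlingSeq'_pos m
  have hm0 : (0 : ℝ) < (m + 1 : ℕ) := by linarith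
  have hpi : (0 : ℝ) < √π := by positivity
  rw [← log_le_log_iff (by positivity) (by positivity), log_mul (by positivity) (by positivity),
    log_div hq.ne' (by positivity), log_mul (by norm_num) (by positivity), log_pow, log_pow,
    log_pow]
  push_cast at h ⊢
  linarith

theorem ramanujan_stirling_lower (n : ℕ) (hn : 0 < n) :
    ((Nat.factorial n : ℝ) / (Real.sqrt π * ((n : ℝ) / Real.exp 1) ^ n)) ^ 6
      - 8 * (n : ℝ) ^ 3 - 4 * (n : ℝ) ^ 2 - (n : ℝ)
      ≥ (1 - 3 / (2 * (n : ℝ))) / 30 := by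
  have hn0 : (0 : ℝ) < n := by exact_mod_cast hn
  have hpi : (0 : ℝ) < √π := by positivity
  have hfac : (Nat.factorial n : ℝ) / (√π * ((n : ℝ) / exp 1) ^ n) =
      √(2 * n) * (Stirling.stirlingSeq n / √π) := by
    have : (0 : ℝ) < √(2 * n) := by positivity
    rw [Stirling.stirlingSeq]
    field
  have hsqrt : √(2 * (n : ℝ)) ^ 6 = 8 * (n : ℝ) ^ 3 := by
    rw [show √(2 * (n : ℝ)) ^ 6 = (√(2 * (n : ℝ)) ^ 2) ^ 3 by ring, sq_sqrt (by positivity)]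
    ring
  have hratio : ramanujanQuartic n / (480 * (n : ℝ) ^ 4) ≤
      (Stirling.stirlingSeq n / √π) ^ 6 := by
    rw [div_pow, le_div_iff₀ (by positivity), mul_comm]
    exact ramanujanQuartic_div_le_stirlingSeq_pow hn
  have hmul := mul_le_mul_of_nonneg_left hratio (show 0 ≤ 8 * (n : ℝ) ^ 3 by positivity)
  have hpoly : 8 * (n : ℝ) ^ 3 * (ramanujanQuartic n / (480 * (n : ℝ) ^ 4)) =
      8 * (n : ℝ) ^ 3 + 4 * (n : ℝ) ^ 2 + n + (1 - 3 / (2 * (n : ℝ))) / 30 := by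
    rw [ramanujanQuartic]
    field
  rw [hfac, mul_pow, hsqrt]
  linarith
end

section
/- For every positive integer n, θ_n ≥ 1 - 3/(2n). -/
open Real

open Filter Topology

/-- The truncated asymptotic expansion bounding `(Stirling.stirlingSeq n / √π) ^ 6` from below. -/
noncomputable def stirlingSixthMinorant (x : ℝ) : ℝ :=
  1 + 1 / (2 * x) + 1 / (8 * x ^ 2) + 1 / (240 * x ^ 3) - 1 / (160 * x ^ 4)

theorem stirlingSixthMinorant_pos {x : ℝ} (hx : 1 ≤ x) : 0 < stirlingSixthMinorant x := by
  have hx0 : 0 < x := by linarith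
  have h : 1 / (160 * x ^ 4) ≤ 1 / 160 := by
    apply one_div_le_one_div_of_le (by norm_num)
    linarith [one_le_pow₀ hx (n := 4)]
  have h' : 0 < 1 / (2 * x) + 1 / (8 * x ^ 2) + 1 / (240 * x ^ 3) := by positivity
  unfold stirlingSixthMinorant
  linarith

theorem tendsto_stirlingSixthMinorant : Tendsto stirlingSixthMinorant atTop (𝓝 1) := by
  have h (c : ℝ) {k : ℕ} (hk : k ≠ 0) : Tendsto (fun x : ℝ => 1 / (c * x ^ k)) atTop (𝓝 0) := by
    have := (tendsto_inv_atTop_zero.comp (tendsto_pow_atTop (α := ℝ) hk)).const_mul c⁻¹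
    simpa [Function.comp_def, mul_comm] using this
  have := (((tendsto_const_nhds (x := (1 : ℝ))).add (h 2 one_ne_zero)).add
    (h 8 two_ne_zero)).add (h 240 three_ne_zero) |>.sub (h 160 four_ne_zero)
  simpa only [pow_one, add_zero, sub_zero] using! this

theorem stirlingSixthMinorant_le_mul_exp {x : ℝ} (hx : 0 < x)
    (h : 0 ≤ stirlingSixthMinorant (x + 1)) :
    stirlingSixthMinorant x ≤ stirlingSixthMinorant (x + 1) *
      exp (6 * (1 / 3 * (1 / (2 * x + 1)) ^ 2 + 1 / 5 * (1 / (2 * x + 1)) ^ 4)) := by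
  set u := 6 * (1 / 3 * (1 / (2 * x + 1)) ^ 2 + 1 / 5 * (1 / (2 * x + 1)) ^ 4) with hu
  have hexp : 1 + u + u ^ 2 / 2 + u ^ 3 / 6 ≤ exp u := by
    have := Real.sum_le_exp_of_nonneg (x := u) (by positivity) 4
    simpa [Finset.sum_range_succ, Nat.factorial] using this
  refine le_trans ?_ (mul_le_mul_of_nonneg_left hexp h)
  rw [hu]
  unfold stirlingSixthMinorant
  rw [← sub_nonneg]
  field_simp
  ring_nf
  positivity

theorem Stirling.exp_mul_stirlingSeq_pow_six_le (m : ℕ) :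
    exp (6 * (1 / 3 * (1 / (2 * ((m + 1 : ℕ) : ℝ) + 1)) ^ 2
      + 1 / 5 * (1 / (2 * ((m + 1 : ℕ) : ℝ) + 1)) ^ 4)) * stirlingSeq (m + 2) ^ 6 ≤
      stirlingSeq (m + 1) ^ 6 := by
  have hsum := (log_stirlingSeq_sdiff_hasSum m).summable.sum_le_tsum (Finset.range 2)
    (fun k _ => by positivity)
  rw [(log_stirlingSeq_sdiff_hasSum m).tsum_eq] at hsum
  have h1 := stirlingSeq'_pos m
  have h2 := stirlingSeq'_pos (m + 1)
  rw [← Real.log_le_log_iff (by positivity) (by positivity),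
    Real.log_mul (by positivity) (by positivity), Real.log_exp, Real.log_pow, Real.log_pow]
  norm_num [Finset.sum_range_succ, ← pow_mul] at hsum ⊢
  linarith

theorem sqrt_pi_pow_six : √π ^ 6 = π ^ 3 := by
  rw [pow_mul _ 2 3, Real.sq_sqrt pi_pos.le]

theorem Stirling.pi_pow_three_mul_le_stirlingSeq_pow_six (m : ℕ) :
    π ^ 3 * stirlingSixthMinorant ((m + 1 : ℕ) : ℝ) ≤ stirlingSeq (m + 1) ^ 6 := by
  have hpos (k : ℕ) : 0 < stirlingSixthMinorant ((k + 1 : ℕ) : ℝ) :=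
    stirlingSixthMinorant_pos (by exact_mod_cast Nat.le_add_left 1 k)
  have hanti : Antitone fun k : ℕ =>
      stirlingSeq (k + 1) ^ 6 / stirlingSixthMinorant ((k + 1 : ℕ) : ℝ) := by
    refine antitone_nat_of_succ_le fun k => ?_
    rw [div_le_div_iff₀ (hpos _) (hpos _)]
    have h := stirlingSixthMinorant_le_mul_exp (x := ((k + 1 : ℕ) : ℝ)) (by positivity)
      (by exact_mod_cast (hpos (k + 1)).le)
    rw [← Nat.cast_succ] at h
    have hs : 0 ≤ stirlingSeq (k + 1 + 1) ^ 6 := by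
      have := stirlingSeq'_pos (k + 1)
      positivity
    calc
      _ ≤ _ := mul_le_mul_of_nonneg_left h hs
      _ = stirlingSixthMinorant ((k + 1 + 1 : ℕ) : ℝ) * (_ * stirlingSeq (k + 2) ^ 6) := by
        rw [mul_comm, mul_assoc]
      _ ≤ _ := mul_le_mul_of_nonneg_left (exp_mul_stirlingSeq_pow_six_le k) (hpos (k + 1)).le
      _ = _ := mul_comm _ _
  have hlim : Tendsto (fun k : ℕ =>
      stirlingSeq (k + 1) ^ 6 / stirlingSixthMinorant ((k + 1 : ℕ) : ℝ)) atTop (𝓝 (π ^ 3)) := by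
    have := ((tendsto_stirlingSeq_sqrt_pi.pow 6).div
      (tendsto_stirlingSixthMinorant.comp tendsto_natCast_atTop_atTop) one_ne_zero).comp
      (tendsto_add_atTop_nat 1)
    rwa [div_one, sqrt_pi_pow_six] at this
  exact (le_div_iff₀ (hpos m)).mp (hanti.le_of_tendsto hlim m)

theorem ramanujanTheta_eq {n : ℕ} (hn : 0 < n) :
    ramanujanTheta n = 30 * (8 * (n : ℝ) ^ 3 * Stirling.stirlingSeq n ^ 6 / π ^ 3
      - 8 * (n : ℝ) ^ 3 - 4 * (n : ℝ) ^ 2 - (n : ℝ)) := by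
  have hn' : (0 : ℝ) < n := by exact_mod_cast hn
  have hsqrt : √(2 * (n : ℝ)) ^ 6 = 8 * (n : ℝ) ^ 3 := by
    rw [pow_mul _ 2 3, Real.sq_sqrt (by positivity)]
    ring
  have hpow : 0 < ((n : ℝ) / exp 1) ^ n := by positivity
  unfold ramanujanTheta Stirling.stirlingSeq
  generalize ((n : ℝ) / exp 1) ^ n = y at *
  rw [div_pow, div_pow, mul_pow, mul_pow, sqrt_pi_pow_six, hsqrt]
  field_simp

theorem ramanujanTheta_ge (n : ℕ) (hn : 0 < n) :
    ramanujanTheta n ≥ 1 - 3 / (2 * (n : ℝ)) := by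
  have hn' : (0 : ℝ) < n := by exact_mod_cast hn
  have key : stirlingSixthMinorant n ≤ Stirling.stirlingSeq n ^ 6 / π ^ 3 := by
    obtain ⟨m, rfl⟩ := Nat.exists_eq_succ_of_ne_zero hn.ne'
    rw [le_div_iff₀ (by positivity), mul_comm]
    exact Stirling.pi_pow_three_mul_le_stirlingSeq_pow_six m
  have hmul := mul_le_mul_of_nonneg_left key (by positivity : (0 : ℝ) ≤ 8 * (n : ℝ) ^ 3)
  have heq : 8 * (n : ℝ) ^ 3 * stirlingSixthMinorant n =
      8 * (n : ℝ) ^ 3 + 4 * (n : ℝ) ^ 2 + n + (1 - 3 / (2 * (n : ℝ))) / 30 := by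
    unfold stirlingSixthMinorant
    field_simp
    ring
  rw [heq, ← mul_div_assoc] at hmul
  rw [ramanujanTheta_eq hn]
  linarith
end

section
/- For every integer n > 1, e · (n-1)^{n-1} / n^{n-1} ≥ 1 + 1/(2n) + 7/(24n²) + 3/(16n³) + 743/(5760n⁴) + 215/(2304n⁵). -/
/-- The first five terms of the expansion
`1 + (1 / x - 1) * log (1 - x) = ∑ x ^ k / (k * (k + 1))` bound it from below. -/
theorem sum_le_one_add_mul_log_one_sub {x : ℝ} (h0 : 0 < x) (h1 : x ≤ 1 / 2) :
    x / 2 + x ^ 2 / 6 + x ^ 3 / 12 + x ^ 4 / 20 + x ^ 5 / 30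
      ≤ 1 + (1 / x - 1) * Real.log (1 - x) := by
  have hx1 : 0 < 1 - x := by linarith
  have hlog := (abs_le.mp (Real.abs_log_sub_add_sum_range_le
    (x := x) (by rw [abs_of_pos h0]; linarith) 12)).1
  rw [abs_of_pos h0] at hlog
  have hmul := mul_le_mul_of_nonneg_left hlog hx1.le
  have hcancel : (1 - x) * -(x ^ (12 + 1) / (1 - x)) = -x ^ 13 := by
    field_simp
  rw [hcancel] at hmul
  simp only [Finset.sum_range_succ, Finset.sum_range_zero] at hmul
  have hpow : x ^ 13 ≤ x ^ 7 / 64 := by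
    have h6 : x ^ 6 ≤ (1 / 2) ^ 6 := pow_le_pow_left₀ h0.le h1 6
    have h7 := mul_le_mul_of_nonneg_left h6 (pow_pos h0 7).le
    nlinarith
  have key : x * (x / 2 + x ^ 2 / 6 + x ^ 3 / 12 + x ^ 4 / 20 + x ^ 5 / 30)
      ≤ x + (1 - x) * Real.log (1 - x) := by
    have p7 := pow_pos h0 7
    have p8 := pow_pos h0 8
    have p9 := pow_pos h0 9
    have p10 := pow_pos h0 10
    have p11 := pow_pos h0 11
    have p12 := pow_pos h0 12
    have p13 := pow_pos h0 13
    norm_num at hmul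
    linarith
  have hdiv : 1 + (1 / x - 1) * Real.log (1 - x)
      = (x + (1 - x) * Real.log (1 - x)) / x := by
    field_simp
  rw [hdiv, le_div_iff₀ h0]
  linarith

/-- A quintic lower bound for the exponential of the series `∑ x ^ k / (k * (k + 1))`. -/
theorem quintic_le_exp_sum {x : ℝ} (h0 : 0 ≤ x) :
    1 + x / 2 + 7 * x ^ 2 / 24 + 3 * x ^ 3 / 16 + 743 * x ^ 4 / 5760 + 215 * x ^ 5 / 2304
      ≤ Real.exp (x / 2 + x ^ 2 / 6 + x ^ 3 / 12 + x ^ 4 / 20 + x ^ 5 / 30) := by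
  refine le_trans ?_ (Real.sum_le_exp_of_nonneg (by positivity) 6)
  simp only [Finset.sum_range_succ, Finset.sum_range_zero, Nat.factorial]
  rw [← sub_nonneg]
  ring_nf
  positivity

theorem e_mul_pow_ratio_ge (n : ℕ) (hn : 1 < n) :
    Real.exp 1 * ((n : ℝ) - 1) ^ (n - 1) / (n : ℝ) ^ (n - 1)
      ≥ 1 + 1 / (2 * (n : ℝ)) + 7 / (24 * (n : ℝ) ^ 2) + 3 / (16 * (n : ℝ) ^ 3)
        + 743 / (5760 * (n : ℝ) ^ 4) + 215 / (2304 * (n : ℝ) ^ 5) := by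
  have hn2 : (2 : ℝ) ≤ n := by exact_mod_cast hn
  have hn0 : (0 : ℝ) < n := by linarith
  have hx0 : (0 : ℝ) < 1 / n := by positivity
  have hx1 : (1 : ℝ) / n ≤ 1 / 2 := one_div_le_one_div_of_le two_pos hn2
  have hpos : (0 : ℝ) < 1 - 1 / n := by linarith
  have hexp : Real.exp 1 * ((n : ℝ) - 1) ^ (n - 1) / (n : ℝ) ^ (n - 1)
      = Real.exp (1 + (1 / (1 / (n : ℝ)) - 1) * Real.log (1 - 1 / n)) := by
    have hcast : 1 / (1 / (n : ℝ)) - 1 = ((n - 1 : ℕ) : ℝ) := by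
      rw [one_div_one_div, Nat.cast_sub hn.le, Nat.cast_one]
    rw [hcast, Real.exp_add, Real.exp_nat_mul, Real.exp_log hpos, mul_div_assoc, ← div_pow,
      sub_div, div_self hn0.ne']
  rw [hexp, ge_iff_le]
  refine le_trans (le_of_eq ?_) ((quintic_le_exp_sum hx0.le).trans
    (Real.exp_le_exp.mpr (sum_le_one_add_mul_log_one_sub hx0 hx1)))
  field_simp
end

section
/- For every real number u with 0 < u ≤ 1, 180 · (1+u)³ · (2+u) · ln(1+u) > 360u + 1080u² + 1110u³ + 420u⁴ + 27u⁵ - 3u⁶ - u⁷. -/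
theorem two_mul_add_pow_three_add_pow_five_le_log_one_add {u : ℝ} (hu : 0 ≤ u) :
    2 * (u / (2 + u) + (u / (2 + u)) ^ 3 / 3 + (u / (2 + u)) ^ 5 / 5) ≤ Real.log (1 + u) := by
  have hx1 : u / (2 + u) < 1 := by
    rw [div_lt_one (by positivity)]
    linarith
  have h := Real.sum_range_le_log_div (by positivity) hx1 3
  have hdiv : (1 + u / (2 + u)) / (1 - u / (2 + u)) = 1 + u := by
    have : (2 + u) ≠ 0 := by positivity
    have : 1 - u / (2 + u) ≠ 0 := by linarith
    rw [div_eq_iff this]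
    field_simp
    ring
  rw [hdiv] at h
  norm_num [Finset.sum_range_succ] at h
  linarith

theorem log_poly_ineq (u : ℝ) (hu0 : 0 < u) (hu1 : u ≤ 1) :
    180 * (1 + u) ^ 3 * (2 + u) * Real.log (1 + u) >
      360 * u + 1080 * u ^ 2 + 1110 * u ^ 3 + 420 * u ^ 4
        + 27 * u ^ 5 - 3 * u ^ 6 - u ^ 7 := by
  refine lt_of_lt_of_le ?_ (mul_le_mul_of_nonneg_left
    (two_mul_add_pow_three_add_pow_five_le_log_one_add hu0.le) (by positivity))
  rw [← sub_pos]
  have key : 180 * (1 + u) ^ 3 * (2 + u) *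
        (2 * (u / (2 + u) + (u / (2 + u)) ^ 3 / 3 + (u / (2 + u)) ^ 5 / 5)) -
      (360 * u + 1080 * u ^ 2 + 1110 * u ^ 3 + 420 * u ^ 4
        + 27 * u ^ 5 - 3 * u ^ 6 - u ^ 7) =
      u ^ 7 * (20 + 50 * u + 62 * u ^ 2 + 43 * u ^ 3 + 13 * u ^ 4 + u ^ 5) / (2 + u) ^ 5 := by
    field_simp
    ring
  rw [key]
  positivity
end

section
/- For every real number u with 0 < u ≤ 1, exp(u/2 - u³/60) ≥ 1 + u/2 + u²/8 + u³/240 - 11u⁴/1920 - u⁵/480 - u⁶/4800. -/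
theorem exp_poly_lower (u : ℝ) (hu0 : 0 < u) (hu1 : u ≤ 1) :
    Real.exp (u / 2 - u ^ 3 / 60) ≥
      1 + u / 2 + u ^ 2 / 8 + u ^ 3 / 240 - 11 * u ^ 4 / 1920
        - u ^ 5 / 480 - u ^ 6 / 4800 := by
  have h3 : u ^ 3 ≤ u := pow_le_of_le_one hu0.le hu1 (by norm_num)
  have hx : 0 ≤ u / 2 - u ^ 3 / 60 := by linarith
  have hexp := Real.sum_le_exp_of_nonneg hx 5
  have h9 : u ^ 9 ≤ u ^ 7 := pow_le_pow_of_le_one hu0.le hu1 (by norm_num)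
  have h10 : u ^ 10 ≤ u ^ 8 := pow_le_pow_of_le_one hu0.le hu1 (by norm_num)
  have h7 : 0 < u ^ 7 := by positivity
  have h8 : 0 < u ^ 8 := by positivity
  have h12 : 0 < u ^ 12 := by positivity
  refine le_trans ?_ hexp
  norm_num [Finset.sum_range_succ, Nat.factorial]
  ring_nf
  linarith
end

section
/- For every real number u with 0 < u < 1, 1 ≥ ((1-u)/u) · ln(1 + u/(1-u)) + ln(1 + u/2 + 7u²/24 + 3u³/16 + 743u⁴/5760 + 215u⁵/2304). -/
/-- The expansion `u + (1 - u) log (1 - u) = ∑ uᵏ⁺¹ / (k (k + 1))`, summed over `k ≥ 1`. -/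
theorem hasSum_pow_div_mul_succ {u : ℝ} (hu : |u| < 1) :
    HasSum (fun n : ℕ => u ^ (n + 2) / ((n + 1) * (n + 2))) (u + (1 - u) * Real.log (1 - u)) := by
  have h := Real.hasSum_pow_div_log_of_abs_lt_one hu
  have h_shift := (hasSum_nat_add_iff' 1).mpr h
  have h_term : ∀ n : ℕ, u ^ (n + 2) / ((n + 1 : ℝ) * (n + 2)) =
      u * (u ^ (n + 1) / (n + 1)) - u ^ (n + 1 + 1) / ((n + 1 : ℕ) + 1 : ℝ) := by
    intro n
    have h1 : (n : ℝ) + 1 ≠ 0 := by positivity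
    have h2 : (n : ℝ) + 2 ≠ 0 := by positivity
    have h3 : (n : ℝ) + 1 + 1 ≠ 0 := by positivity
    push_cast
    field_simp
    ring
  have h_sum : u + (1 - u) * Real.log (1 - u) = u * -Real.log (1 - u)
      - (-Real.log (1 - u) - ∑ i ∈ Finset.range 1, u ^ (i + 1) / ((i : ℝ) + 1)) := by
    simp
    ring
  simp only [h_term, h_sum]
  exact (h.mul_left u).sub h_shift

theorem one_ge_log_sum (u : ℝ) (hu0 : 0 < u) (hu1 : u < 1) :
    1 ≥ (1 - u) / u * Real.log (1 + u / (1 - u))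
      + Real.log (1 + u / 2 + 7 * u ^ 2 / 24 + 3 * u ^ 3 / 16
          + 743 * u ^ 4 / 5760 + 215 * u ^ 5 / 2304) := by
  have h1u : 0 < 1 - u := sub_pos.mpr hu1
  set T : ℝ := u / 2 + u ^ 2 / 6 + u ^ 3 / 12 + u ^ 4 / 20 + u ^ 5 / 30 with hT
  have h_series : u * T ≤ u + (1 - u) * Real.log (1 - u) := by
    have h := sum_le_hasSum (Finset.range 5) (fun n _ => by positivity)
      (hasSum_pow_div_mul_succ (abs_lt.mpr ⟨by linarith, hu1⟩))
    norm_num [Finset.sum_range_succ] at h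
    rw [hT]
    linarith
  have h_log : Real.log (1 + u / (1 - u)) = -Real.log (1 - u) := by
    rw [← Real.log_inv]
    congr 1
    field_simp
    ring
  have h_first : (1 - u) / u * Real.log (1 + u / (1 - u)) ≤ 1 - T := by
    rw [h_log, div_mul_eq_mul_div, div_le_iff₀ hu0]
    linarith
  have h_second : Real.log (1 + u / 2 + 7 * u ^ 2 / 24 + 3 * u ^ 3 / 16
      + 743 * u ^ 4 / 5760 + 215 * u ^ 5 / 2304) ≤ T := by
    rw [Real.log_le_iff_le_exp (by positivity)]
    refine le_trans ?_ (Real.sum_le_exp_of_nonneg (by positivity : 0 ≤ T) 6)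
    rw [← sub_nonneg]
    simp only [Finset.sum_range_succ, Finset.sum_range_zero, Nat.factorial, hT]
    push_cast
    ring_nf
    positivity
  linarith
end
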